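/- Let N ≥ 1, let A be a constant N×N complex matrix, and let B : ℝ → (N×2 complex matrices) and 𝕏 : ℝ → (N×N complex matrices) be continuously differentiable, with 𝕏(x) Hermitian and invertible for all x. Assume that for all x: (i) d/dx (B σ₁) + A B σ₂ + B γ = 0; (ii) A 𝕏 + 𝕏 A* + B σ₁ B* = 0; (iii) d𝕏/dx = B σ₂ B*. Define γ_*(x) := γ + σ₂ B(x)* 𝕏(x)⁻¹ B(x) σ₁ − σ₁ B(x)* 𝕏(x)⁻¹ B(x) σ₂, and for λ not an eigenvalue of A define S(λ,x) := I₂ − B(x)* 𝕏(x)⁻¹ (λ Iₙ − A)⁻¹ B(x) σ₁. Then S satisfies the differential equation ∂S/∂x (λ,x) = σ₁ (λ σ₂ + γ_*(x)) S(λ,x) − S(λ,x) σ₁ (λ σ₂ + γ) (note σ₁⁻¹ = σ₁). -/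

import Mathlib

open Matrix Complex

noncomputable section

/-- The fixed 2×2 matrix σ₁ = [[0,1],[1,0]]. -/
def sigma1 : Matrix (Fin 2) (Fin 2) ℂ := !![0, 1; 1, 0]

/-- The fixed 2×2 matrix σ₂ = [[1,0],[0,0]]. -/
def sigma2 : Matrix (Fin 2) (Fin 2) ℂ := !![1, 0; 0, 0]

/-- The fixed 2×2 matrix γ = [[0,0],[0,i]]. -/
def gammaM : Matrix (Fin 2) (Fin 2) ℂ := !![0, 0; 0, Complex.I]

attribute [local instance] Matrix.normedAddCommGroup Matrix.normedSpace

theorem hasDerivAt_entry {m n : Type*} [Fintype m] [Fintype n]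
    {F : ℝ → Matrix m n ℂ} {F' : Matrix m n ℂ} {x : ℝ} :
    HasDerivAt F F' x ↔ ∀ i j, HasDerivAt (fun y => F y i j) (F' i j) x := by
  constructor
  · intro h i j
    exact hasDerivAt_pi.1 (hasDerivAt_pi.1 h i) j
  · intro h
    exact hasDerivAt_pi.2 fun i => hasDerivAt_pi.2 fun j => h i j

theorem hasDerivAt_mmul {m n p : Type*} [Fintype m] [Fintype n] [Fintype p]
    {F : ℝ → Matrix m n ℂ} {F' : Matrix m n ℂ} {G : ℝ → Matrix n p ℂ} {G' : Matrix n p ℂ} {x : ℝ}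
    (hF : HasDerivAt F F' x) (hG : HasDerivAt G G' x) :
    HasDerivAt (fun y => F y * G y) (F' * G x + F x * G') x := by
  rw [hasDerivAt_entry] at *
  intro i j
  simp only [Matrix.mul_apply, Matrix.add_apply, ← Finset.sum_add_distrib]
  exact HasDerivAt.fun_sum fun k _ => (hF i k).mul (hG k j)

theorem hasDerivAt_const_sub_m {m n : Type*} [Fintype m] [Fintype n]
    {F : ℝ → Matrix m n ℂ} {F' : Matrix m n ℂ} {x : ℝ} (M : Matrix m n ℂ)
    (hF : HasDerivAt F F' x) : HasDerivAt (fun y => M - F y) (-F') x := by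
  rw [hasDerivAt_entry] at *
  intro i j
  exact (hF i j).const_sub (M i j)

theorem hasDerivAt_star {m n : Type*} [Fintype m] [Fintype n]
    {F : ℝ → Matrix m n ℂ} {F' : Matrix m n ℂ} {x : ℝ} (hF : HasDerivAt F F' x) :
    HasDerivAt (fun y => (F y)ᴴ) (F'ᴴ) x := by
  rw [hasDerivAt_entry] at *
  intro i j
  exact (hF j i).star

theorem differentiable_det {n : ℕ} {F : ℝ → Matrix (Fin n) (Fin n) ℂ} {x : ℝ}
    (hF : ∀ i j, DifferentiableAt ℝ (fun y => F y i j) x) :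
    DifferentiableAt ℝ (fun y => (F y).det) x := by
  simp only [Matrix.det_apply']
  exact DifferentiableAt.fun_sum fun s _ =>
    (differentiableAt_const _).mul (DifferentiableAt.fun_finsetProd fun i _ => hF _ _)

theorem hasDerivAt_minv {n : ℕ} {F : ℝ → Matrix (Fin n) (Fin n) ℂ}
    {F' : Matrix (Fin n) (Fin n) ℂ} {x : ℝ} (hF : HasDerivAt F F' x) (hu : ∀ y, IsUnit (F y)) :
    HasDerivAt (fun y => (F y)⁻¹) (-((F x)⁻¹ * F' * (F x)⁻¹)) x := by
  have hud : ∀ y, IsUnit (F y).det := fun y => (Matrix.isUnit_iff_isUnit_det _).1 (hu y)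
  have he : ∀ i j, DifferentiableAt ℝ (fun y => F y i j) x :=
    fun i j => (hasDerivAt_entry.1 hF i j).differentiableAt
  have hd : ∀ i j, DifferentiableAt ℝ (fun y => (F y)⁻¹ i j) x := by
    intro i j
    simp only [Matrix.inv_def, Ring.inverse_eq_inv', Matrix.smul_apply, smul_eq_mul,
      Matrix.adjugate_apply]
    refine ((differentiable_det he).inv (hud x).ne_zero).mul (differentiable_det ?_)
    intro a b
    by_cases h : a = j
    · subst h
      simp
    · simpa [Matrix.updateRow_ne h] using he a b
  have hG : HasDerivAt (fun y => (F y)⁻¹)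
      (Matrix.of fun i j => deriv (fun y => (F y)⁻¹ i j) x) x :=
    hasDerivAt_entry.2 fun i j => (hd i j).hasDerivAt
  set G' := (Matrix.of fun i j => deriv (fun y => (F y)⁻¹ i j) x) with hG'
  have h := hasDerivAt_mmul hF hG
  have hc : (fun y => F y * (F y)⁻¹) = fun _ => 1 := by
    funext y; exact Matrix.mul_nonsing_inv _ (hud y)
  rw [hc] at h
  have h0 := h.unique (hasDerivAt_const x (1 : Matrix (Fin n) (Fin n) ℂ))
  have : G' = -((F x)⁻¹ * F' * (F x)⁻¹) := by
    have h4 : (F x)⁻¹ * (F' * (F x)⁻¹ + F x * G') = 0 := by rw [h0, mul_zero]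
    rw [mul_add, ← mul_assoc, ← mul_assoc, Matrix.nonsing_inv_mul _ (hud x), one_mul] at h4
    exact eq_neg_of_add_eq_zero_right h4
  rwa [← this]

theorem sigma1_sq : sigma1 * sigma1 = 1 := by
  ext i j; fin_cases i <;> fin_cases j <;> simp [sigma1, Matrix.mul_apply]

theorem sigma1_star : sigma1ᴴ = sigma1 := by
  ext i j; fin_cases i <;> fin_cases j <;> simp [sigma1]

theorem sigma2_star : sigma2ᴴ = sigma2 := by
  ext i j; fin_cases i <;> fin_cases j <;> simp [sigma2]

theorem gammaM_star : gammaMᴴ = -gammaM := by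
  ext i j; fin_cases i <;> fin_cases j <;> simp [gammaM]

/-- for a Sturm–Liouville vessel, the transfer function
`S(λ,x) = I − B(x)* 𝕏(x)⁻¹ (λI − A)⁻¹ B(x) σ₁` satisfies the differential equation
`∂S/∂x = σ₁ (λσ₂ + γ_*) S − S σ₁ (λσ₂ + γ)`, where
`γ_* = γ + σ₂ B* 𝕏⁻¹ B σ₁ − σ₁ B* 𝕏⁻¹ B σ₂` (note `σ₁⁻¹ = σ₁`). -/
theorem transfer_function_ODE (N : ℕ) (hN : 1 ≤ N)
    (A : Matrix (Fin N) (Fin N) ℂ)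
    (B : ℝ → Matrix (Fin N) (Fin 2) ℂ)
    (X : ℝ → Matrix (Fin N) (Fin N) ℂ)
    (hBsmooth : ContDiff ℝ 1 B) (hXsmooth : ContDiff ℝ 1 X)
    (hherm : ∀ x, (X x).IsHermitian) (hinv : ∀ x, IsUnit (X x))
    (h1 : ∀ x, HasDerivAt (fun x' => B x' * sigma1)
      (-(A * B x * sigma2 + B x * gammaM)) x)
    (h2 : ∀ x, A * X x + X x * Aᴴ + B x * sigma1 * (B x)ᴴ = 0)
    (h3 : ∀ x, HasDerivAt X (B x * sigma2 * (B x)ᴴ) x)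
    (gammaStar : ℝ → Matrix (Fin 2) (Fin 2) ℂ)
    (hgs : ∀ x, gammaStar x = gammaM + sigma2 * (B x)ᴴ * (X x)⁻¹ * B x * sigma1
      - sigma1 * (B x)ᴴ * (X x)⁻¹ * B x * sigma2)
    (S : ℂ → ℝ → Matrix (Fin 2) (Fin 2) ℂ)
    (hS : ∀ l x, S l x =
      1 - (B x)ᴴ * (X x)⁻¹ * (l • (1 : Matrix (Fin N) (Fin N) ℂ) - A)⁻¹ * B x * sigma1) :
    ∀ l : ℂ, IsUnit (l • (1 : Matrix (Fin N) (Fin N) ℂ) - A) →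
      ∀ x : ℝ, HasDerivAt (fun x' => S l x')
        (sigma1 * (l • sigma2 + gammaStar x) * S l x - S l x * (sigma1 * (l • sigma2 + gammaM))) x := by
  intro l hl x
  have hXd : IsUnit (X x).det := (Matrix.isUnit_iff_isUnit_det _).1 (hinv x)
  have hld := (Matrix.isUnit_iff_isUnit_det _).1 hl
  set R := (l • (1 : Matrix (Fin N) (Fin N) ℂ) - A)⁻¹ with hR
  have hAR : A * R = l • R - 1 := by
    have h := Matrix.mul_nonsing_inv _ hld
    rw [← hR, sub_mul, smul_mul_assoc, one_mul] at h
    rw [← h]; abel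
  have hRA : R * A = l • R - 1 := by
    have h := Matrix.nonsing_inv_mul _ hld
    rw [← hR, mul_sub, mul_smul_comm, mul_one] at h
    rw [← h]; abel
  have hB : HasDerivAt (fun y => B y) (-(A * B x * sigma2 + B x * gammaM) * sigma1) x := by
    have h := hasDerivAt_mmul (h1 x) (hasDerivAt_const x sigma1)
    simpa only [Matrix.mul_assoc, sigma1_sq, Matrix.mul_one, Matrix.mul_zero, add_zero] using h
  have hC := hasDerivAt_mmul (hasDerivAt_star hB) (hasDerivAt_minv (h3 x) hinv)
  set C := (B x)ᴴ * (X x)⁻¹ with hCdef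
  have hlyap : (B x)ᴴ * (Aᴴ * (X x)⁻¹) = -(C * A) - C * (B x * (sigma1 * C)) := by
    have h : (B x)ᴴ * ((X x)⁻¹ * (A * X x + X x * Aᴴ + B x * sigma1 * (B x)ᴴ) * (X x)⁻¹) = 0 := by
      rw [h2]; simp
    have e1 : (X x)⁻¹ * (A * X x + X x * Aᴴ + B x * sigma1 * (B x)ᴴ) * (X x)⁻¹
        = (X x)⁻¹ * A + Aᴴ * (X x)⁻¹ + (X x)⁻¹ * (B x * (sigma1 * ((B x)ᴴ * (X x)⁻¹))) := by
      simp only [Matrix.mul_add, Matrix.add_mul, Matrix.mul_assoc,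
        Matrix.mul_nonsing_inv _ hXd, Matrix.nonsing_inv_mul_cancel_left _ _ hXd, Matrix.mul_one]
    rw [e1] at h
    simp only [Matrix.mul_add] at h
    rw [hCdef]
    simp only [Matrix.mul_assoc]
    rw [← sub_eq_zero, ← h]; abel
  have hC' : HasDerivAt (fun y => (B y)ᴴ * (X y)⁻¹)
      (sigma1 * (sigma2 * (C * A)) + sigma1 * (gammaStar x * C)) x := by
    convert hC using 1
    have e : ((-(A * B x * sigma2 + B x * gammaM) * sigma1)ᴴ * (X x)⁻¹ +
        (B x)ᴴ * -((X x)⁻¹ * (B x * sigma2 * (B x)ᴴ) * (X x)⁻¹))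
        = -(sigma1 * (sigma2 * ((B x)ᴴ * (Aᴴ * (X x)⁻¹)))) + sigma1 * (gammaM * C)
          - C * (B x * (sigma2 * C)) := by
      rw [hCdef]
      simp only [Matrix.conjTranspose_mul, Matrix.conjTranspose_add, Matrix.conjTranspose_neg,
        sigma1_star, sigma2_star, gammaM_star, Matrix.mul_assoc, Matrix.mul_neg, Matrix.neg_mul,
        Matrix.mul_add, Matrix.add_mul]
      abel
    rw [e, hlyap, hgs]
    have hq : sigma1 * (sigma1 * (C * (B x * (sigma2 * C)))) = C * (B x * (sigma2 * C)) := by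
      rw [← Matrix.mul_assoc, sigma1_sq, Matrix.one_mul]
    have hgc : (gammaM + sigma2 * (B x)ᴴ * (X x)⁻¹ * B x * sigma1
        - sigma1 * (B x)ᴴ * (X x)⁻¹ * B x * sigma2) * C = gammaM * C
        + sigma2 * (C * (B x * (sigma1 * C))) - sigma1 * (C * (B x * (sigma2 * C))) := by
      rw [hCdef]
      simp only [Matrix.sub_mul, Matrix.add_mul, Matrix.mul_assoc]
    rw [hgc]
    simp only [Matrix.mul_sub, Matrix.mul_add, Matrix.mul_neg, hq]
    abel
  have hT := hasDerivAt_mmul (hasDerivAt_mmul hC' (hasDerivAt_const x R)) (h1 x)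
  have hfin := hasDerivAt_const_sub_m (1 : Matrix (Fin 2) (Fin 2) ℂ) hT
  have hSf : (fun y => S l y) = fun y => 1 - (B y)ᴴ * (X y)⁻¹ * R * (B y * sigma1) := by
    funext y; rw [hS]; simp only [Matrix.mul_assoc, hR]
  rw [hSf]
  convert hfin using 1
  rw [hS, ← hR, ← hCdef, Matrix.mul_zero, add_zero]
  have hg : sigma1 * gammaStar x = sigma1 * gammaM + sigma1 * (sigma2 * (C * (B x * sigma1)))
      - C * (B x * sigma2) := by
    rw [hgs, hCdef, Matrix.mul_sub, Matrix.mul_add]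
    congr 1
    · simp only [Matrix.mul_assoc]
    · simp only [← Matrix.mul_assoc, sigma1_sq, Matrix.one_mul]
  have e1 : (sigma1 * (sigma2 * (C * A)) + sigma1 * (gammaStar x * C)) * R * (B x * sigma1)
      = l • (sigma1 * (sigma2 * (C * (R * (B x * sigma1)))))
        - sigma1 * (sigma2 * (C * (B x * sigma1)))
        + sigma1 * (gammaStar x * (C * (R * (B x * sigma1)))) := by
    have : C * A * R = l • (C * R) - C := by
      rw [Matrix.mul_assoc, hAR, Matrix.mul_sub, Matrix.mul_one, Matrix.mul_smul]
    calc _ = sigma1 * (sigma2 * (C * A * R * (B x * sigma1)))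
          + sigma1 * (gammaStar x * (C * (R * (B x * sigma1)))) := by
            simp only [Matrix.add_mul, Matrix.mul_assoc]
      _ = _ := by
            rw [this]
            simp only [Matrix.sub_mul, Matrix.mul_sub, Matrix.smul_mul, Matrix.mul_smul,
              Matrix.mul_assoc]
  have e2 : C * R * -(A * B x * sigma2 + B x * gammaM)
      = -(l • (C * (R * (B x * sigma2)))) + C * (B x * sigma2) - C * (R * (B x * gammaM)) := by
    have : C * R * A = l • (C * R) - C := by
      rw [Matrix.mul_assoc, hRA, Matrix.mul_sub, Matrix.mul_one, Matrix.mul_smul]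
    calc _ = -(C * R * A * (B x * sigma2)) - C * (R * (B x * gammaM)) := by
            simp only [Matrix.mul_add, Matrix.mul_neg, Matrix.mul_assoc]; abel
      _ = _ := by
            rw [this]
            simp only [Matrix.sub_mul, Matrix.smul_mul, Matrix.mul_assoc]; abel
  have hs : ∀ M : Matrix (Fin 2) (Fin 2) ℂ, sigma1 * (sigma1 * M) = M := fun M => by
    rw [← Matrix.mul_assoc, sigma1_sq, Matrix.one_mul]
  rw [e1, e2]
  simp only [Matrix.mul_sub, Matrix.sub_mul, Matrix.mul_add, Matrix.add_mul, Matrix.mul_smul,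
    Matrix.smul_mul, Matrix.mul_one, Matrix.one_mul, Matrix.mul_assoc, hs, smul_sub]
  rw [hg]
  abel

end
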